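/- arXiv:0803.2778 — 2 statements merged into one kernel-verified Lean document; each statement's English description precedes it below -/
import Mathlib

section
/- Let n ∈ ℕ and let σ₁, σ₂ be the (n+1)×(n+1) complex matrices with entries σ₁_{km} = binom(n-k, n-m) and σ₂_{km} = (-1)^{k+m}·binom(k, m). If an (n+1)×(n+1) complex matrix A satisfies A·σ₁ = σ₁·A and A·σ₂ = σ₂·A, then A = c·1 for some scalar c ∈ ℂ. -/
/-- A matrix commuting with a lower unitriangular matrix whose subdiagonal entries are nonzero
is lower triangular. -/
theorem Matrix.lower_triangular_of_commute_unitriangular {R : Type*} [Ring R] [NoZeroDivisors R]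
    {n : ℕ} {A T : Matrix (Fin (n + 1)) (Fin (n + 1)) R}
    (hlow : ∀ i j, i < j → T i j = 0) (hdiag : ∀ i, T i i = 1)
    (hsub : ∀ i : Fin n, T i.succ i.castSucc ≠ 0) (h : A * T = T * A) :
    ∀ k m, k < m → A k m = 0 := by
  set N := T - 1 with hN
  have hN0 : ∀ i j, i ≤ j → N i j = 0 := by
    intro i j hij
    rcases hij.eq_or_lt with rfl | hij
    · simp [hN, hdiag]
    · simp [hN, hlow i j hij, Matrix.one_apply_ne hij.ne]
  have hNsub : ∀ i : Fin n, N i.succ i.castSucc ≠ 0 := by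
    intro i
    simpa [hN, Matrix.one_apply_ne (Fin.castSucc_lt_succ (i := i)).ne'] using hsub i
  have hcomm : A * N = N * A := by simp [hN, mul_sub, sub_mul, h]
  intro k
  induction k using WellFoundedLT.induction with
  | _ k ihk =>
    have hzero : ∀ m, k ≤ m → ∑ j, A k j * N j m = 0 := by
      intro m hm
      rw [← Matrix.mul_apply, hcomm, Matrix.mul_apply]
      refine Finset.sum_eq_zero fun j _ => ?_
      rcases lt_or_ge j k with hj | hj
      · rw [ihk j hj m (hj.trans_le hm), mul_zero]
      · rw [hN0 k j hj, zero_mul]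
    intro m
    induction m using WellFoundedGT.induction with
    | _ m ihm =>
      intro hkm
      obtain ⟨i, rfl⟩ := Fin.exists_succ_eq.2 (Fin.ne_zero_of_lt hkm)
      have hi : k ≤ i.castSucc := Fin.le_castSucc_iff.2 hkm
      have hs := hzero i.castSucc hi
      rw [Finset.sum_eq_single i.succ] at hs
      · exact (mul_eq_zero.1 hs).resolve_right (hNsub i)
      · intro j _ hj
        rcases hj.lt_or_gt with hj | hj
        · rw [hN0 j _ (Fin.le_castSucc_iff.2 hj), mul_zero]
        · rw [ihm j hj (hkm.trans hj), zero_mul]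
      · simp

/-- Any complex matrix commuting with both `σ₁` (entries
`binom(n-k, n-m)`) and `σ₂` (entries `(-1)^{k+m} binom(k,m)`) is a scalar multiple of
the identity. -/
theorem pascal_rep_operator_irreducible (n : ℕ)
    (σ1 σ2 : Matrix (Fin (n + 1)) (Fin (n + 1)) ℂ)
    (hσ1 : ∀ k m : Fin (n + 1), σ1 k m = (Nat.choose (n - k.val) (n - m.val) : ℂ))
    (hσ2 : ∀ k m : Fin (n + 1),
      σ2 k m = (-1 : ℂ) ^ (k.val + m.val) * (Nat.choose k.val m.val : ℂ))
    (A : Matrix (Fin (n + 1)) (Fin (n + 1)) ℂ)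
    (h1 : A * σ1 = σ1 * A) (h2 : A * σ2 = σ2 * A) :
    ∃ c : ℂ, A = c • (1 : Matrix (Fin (n + 1)) (Fin (n + 1)) ℂ) := by
  have hlower : ∀ k m, k < m → A k m = 0 := by
    refine Matrix.lower_triangular_of_commute_unitriangular (fun i j hij => ?_) (fun i => ?_)
      (fun i => ?_) h2
    · simp [hσ2, Nat.choose_eq_zero_of_lt hij]
    · simp [hσ2, ← two_mul]
    · rw [hσ2]
      refine mul_ne_zero (pow_ne_zero _ (by simp)) (Nat.cast_ne_zero.2 ?_)
      exact (Nat.choose_pos (by simp)).ne'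
  have hupper : ∀ k m, k < m → A.transpose k m = 0 := by
    refine Matrix.lower_triangular_of_commute_unitriangular (T := σ1.transpose)
      (fun i j hij => ?_) (fun i => ?_) (fun i => ?_) ?_
    · have : n - j.val < n - i.val := by omega
      simp [hσ1, Nat.choose_eq_zero_of_lt this]
    · simp [hσ1]
    · rw [Matrix.transpose_apply, hσ1, Nat.cast_ne_zero]
      exact (Nat.choose_pos (by simp; omega)).ne'
    · rw [← Matrix.transpose_mul, ← Matrix.transpose_mul, h1]
  have hoff : ∀ k m, k ≠ m → A k m = 0 := fun k m hkm =>
    hkm.lt_or_gt.elim (hlower k m) (hupper m k)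
  have hconst : ∀ m, A m m = A 0 0 := by
    intro m
    have hm := congrFun (congrFun h1 0) m
    rw [Matrix.mul_apply, Matrix.mul_apply,
      Finset.sum_eq_single 0 (fun j _ hj => by rw [hoff 0 j hj.symm, zero_mul]) (by simp),
      Finset.sum_eq_single m (fun j _ hj => by rw [hoff j m hj, mul_zero]) (by simp),
      mul_comm] at hm
    refine (mul_left_cancel₀ ?_ hm).symm
    rw [hσ1, Nat.cast_ne_zero]
    exact (Nat.choose_pos (by simp)).ne'
  refine ⟨A 0 0, ?_⟩
  ext k m
  rcases eq_or_ne k m with rfl | hkm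
  · simp [hconst k]
  · simp [hoff k m hkm, Matrix.one_apply_ne hkm]
end

section
/- Let n ∈ ℕ and let σ₁, σ₂ be the (n+1)×(n+1) complex matrices with entries σ₁_{km} = binom(n-k, n-m) and σ₂_{km} = (-1)^{k+m}·binom(k, m). If W is a ℂ-subspace of ℂ^{n+1} that is invariant under the linear maps x ↦ σ₁·x and x ↦ σ₂·x (matrix–vector multiplication), then W = 0 or W = ℂ^{n+1}. -/
section TriangularInvariance

variable {K : Type*} [Field K] {n : ℕ}

/-- A subspace invariant under a strictly upper triangular matrix with nowhere vanishing
superdiagonal, and containing a nonzero vector, contains a vector with nonzero `0`-th entry. -/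
theorem exists_mem_apply_zero_ne_zero (N : Matrix (Fin (n + 1)) (Fin (n + 1)) K)
    (hN : ∀ k m, m ≤ k → N k m = 0) (hN' : ∀ k m, m.val = k.val + 1 → N k m ≠ 0)
    (W : Submodule K (Fin (n + 1) → K)) (hW : ∀ x ∈ W, N.mulVec x ∈ W)
    (hne : W ≠ ⊥) : ∃ w ∈ W, w 0 ≠ 0 := by
  have key : ∀ t : ℕ, t ≤ n → ∀ v ∈ W, v ≠ 0 → (∀ i : Fin (n + 1), t < i.val → v i = 0) →
      ∃ w ∈ W, w 0 ≠ 0 := by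
    intro t
    induction t with
    | zero =>
      intro _ v hv hv0 hvi
      refine ⟨v, hv, fun h => hv0 (funext fun i => ?_)⟩
      rcases Nat.eq_zero_or_pos i.val with hi | hi
      · rwa [show i = 0 from Fin.ext hi]
      · exact hvi i hi
    | succ t ih =>
      intro ht v hv hv0 hvi
      by_cases hvt : v ⟨t + 1, by omega⟩ = 0
      · refine ih (by omega) v hv hv0 fun i hi => ?_
        rcases Nat.lt_or_ge (t + 1) i.val with h | h
        · exact hvi i h
        · rwa [show i = ⟨t + 1, by omega⟩ from Fin.ext (by simp only; omega)]
      · refine ih (by omega) (N.mulVec v) (hW v hv) (fun h => ?_) fun i hi => ?_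
        · have h0 := congrFun h ⟨t, by omega⟩
          rw [Matrix.mulVec, dotProduct, Finset.sum_eq_single ⟨t + 1, by omega⟩] at h0
          · exact mul_ne_zero (hN' _ _ rfl) hvt h0
          · intro m _ hm
            have hm' : m.val ≠ t + 1 := fun h => hm (Fin.ext h)
            rcases Nat.lt_or_ge (t + 1) m.val with h | h
            · rw [hvi m h, mul_zero]
            · rw [hN _ _ (Fin.le_def.2 (by simp only; omega)), zero_mul]
          · simp
        · rw [Matrix.mulVec, dotProduct]
          refine Finset.sum_eq_zero fun m _ => ?_
          rcases Nat.lt_or_ge (t + 1) m.val with h | h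
          · rw [hvi m h, mul_zero]
          · rw [hN _ _ (Fin.le_def.2 (by omega)), zero_mul]
  obtain ⟨v, hv, hv0⟩ := W.ne_bot_iff.1 hne
  exact key n le_rfl v hv hv0 fun i hi => absurd i.isLt (by omega)

/-- A subspace invariant under a strictly lower triangular matrix with nowhere vanishing
subdiagonal, and containing a vector with nonzero `0`-th entry, is the whole space. -/
theorem eq_top_of_mem_apply_zero_ne_zero (N : Matrix (Fin (n + 1)) (Fin (n + 1)) K)
    (hN : ∀ k m, k ≤ m → N k m = 0) (hN' : ∀ k m, k.val = m.val + 1 → N k m ≠ 0)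
    (W : Submodule K (Fin (n + 1) → K)) (hW : ∀ x ∈ W, N.mulVec x ∈ W)
    (hne : ∃ w ∈ W, w 0 ≠ 0) : W = ⊤ := by
  have key : ∀ j : ℕ, ∀ hj : j < n + 1,
      ∃ v ∈ W, (∀ i : Fin (n + 1), i.val < j → v i = 0) ∧ v ⟨j, hj⟩ ≠ 0 := by
    intro j
    induction j with
    | zero =>
      intro _
      obtain ⟨w, hw, hw0⟩ := hne
      exact ⟨w, hw, fun i hi => absurd hi (Nat.not_lt_zero _), hw0⟩
    | succ j ih =>
      intro hj
      obtain ⟨v, hv, hvi, hvj⟩ := ih (by omega)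
      refine ⟨N.mulVec v, hW v hv, fun i hi => ?_, ?_⟩
      · rw [Matrix.mulVec, dotProduct]
        refine Finset.sum_eq_zero fun m _ => ?_
        rcases Nat.lt_or_ge m.val j with h | h
        · rw [hvi m h, mul_zero]
        · rw [hN _ _ (Fin.le_def.2 (by omega)), zero_mul]
      · rw [Matrix.mulVec, dotProduct, Finset.sum_eq_single ⟨j, by omega⟩]
        · exact mul_ne_zero (hN' _ _ rfl) hvj
        · intro m _ hm
          have hm' : m.val ≠ j := fun h => hm (Fin.ext h)
          rcases Nat.lt_or_ge m.val j with h | h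
          · rw [hvi m h, mul_zero]
          · rw [hN _ _ (Fin.le_def.2 (by simp only; omega)), zero_mul]
        · simp
  have span : ∀ d j : ℕ, j + d = n + 1 → ∀ x : Fin (n + 1) → K,
      (∀ i : Fin (n + 1), i.val < j → x i = 0) → x ∈ W := by
    intro d
    induction d with
    | zero =>
      intro j hj x hx
      rw [show x = 0 from funext fun i => hx i (by omega)]
      exact W.zero_mem
    | succ d ih =>
      intro j hj x hx
      obtain ⟨v, hv, hvi, hvj⟩ := key j (by omega)
      set c := x ⟨j, by omega⟩ / v ⟨j, by omega⟩ with hc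
      have hmem : x - c • v ∈ W := by
        refine ih (j + 1) (by omega) _ fun i hi => ?_
        rcases Nat.lt_or_ge i.val j with h | h
        · simp [hx i h, hvi i h]
        · rw [show i = ⟨j, by omega⟩ from Fin.ext (by simp only; omega)]
          simp [hc, div_mul_cancel₀ _ hvj]
      simpa using W.add_mem hmem (W.smul_mem c hv)
  exact Submodule.eq_top_iff'.2 fun x =>
    span (n + 1) 0 (by omega) x fun i hi => absurd hi (Nat.not_lt_zero _)

end TriangularInvariance

/-- Every subspace of `ℂ^{n+1}` invariant under both `σ₁` (entries
`binom(n-k, n-m)`) and `σ₂` (entries `(-1)^{k+m} binom(k,m)`) is trivial: the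
representation is (subspace) irreducible. -/
theorem pascal_rep_subspace_irreducible (n : ℕ)
    (σ1 σ2 : Matrix (Fin (n + 1)) (Fin (n + 1)) ℂ)
    (hσ1 : ∀ k m : Fin (n + 1), σ1 k m = (Nat.choose (n - k.val) (n - m.val) : ℂ))
    (hσ2 : ∀ k m : Fin (n + 1),
      σ2 k m = (-1 : ℂ) ^ (k.val + m.val) * (Nat.choose k.val m.val : ℂ))
    (W : Submodule ℂ (Fin (n + 1) → ℂ))
    (hW1 : ∀ x ∈ W, σ1.mulVec x ∈ W) (hW2 : ∀ x ∈ W, σ2.mulVec x ∈ W) :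
    W = ⊥ ∨ W = ⊤ := by
  have sub_one_mem (σ : Matrix (Fin (n + 1)) (Fin (n + 1)) ℂ)
      (hσ : ∀ x ∈ W, σ.mulVec x ∈ W) (x : Fin (n + 1) → ℂ) (hx : x ∈ W) :
      (σ - 1).mulVec x ∈ W := by
    rw [Matrix.sub_mulVec, Matrix.one_mulVec]
    exact W.sub_mem (hσ x hx) hx
  refine or_iff_not_imp_left.2 fun hne => ?_
  refine eq_top_of_mem_apply_zero_ne_zero (σ2 - 1) (fun k m hkm => ?_) (fun k m hkm => ?_) W
    (sub_one_mem σ2 hW2)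
    (exists_mem_apply_zero_ne_zero (σ1 - 1) (fun k m hkm => ?_) (fun k m hkm => ?_) W
      (sub_one_mem σ1 hW1) hne)
  · rcases hkm.eq_or_lt with rfl | h
    · simp [hσ2, ← two_mul]
    · simp [hσ2, Matrix.one_apply_ne h.ne, Nat.choose_eq_zero_of_lt (Fin.lt_def.1 h)]
  · have hne' : k ≠ m := fun h => by simp [h] at hkm
    rw [Matrix.sub_apply, Matrix.one_apply_ne hne', sub_zero, hσ2, hkm, Nat.choose_succ_self_right]
    exact mul_ne_zero (pow_ne_zero _ (by norm_num)) (Nat.cast_ne_zero.2 (Nat.succ_ne_zero _))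
  · rcases hkm.eq_or_lt with rfl | h
    · simp [hσ1]
    · have h' : n - k.val < n - m.val := by
        have := Fin.lt_def.1 h
        omega
      simp [hσ1, Matrix.one_apply_ne h.ne', Nat.choose_eq_zero_of_lt h']
  · have hne' : k ≠ m := fun h => by simp [h] at hkm
    have hk : n - k.val = (n - m.val) + 1 := by omega
    rw [Matrix.sub_apply, Matrix.one_apply_ne hne', sub_zero, hσ1, hk, Nat.choose_succ_self_right]
    exact Nat.cast_ne_zero.2 (Nat.succ_ne_zero _)
end
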